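/- Let Q = [-1,1]^d, and let u be a tensor-product polynomial of degree at most N in each variable. Then ∫_{∂Q} u² ≤ d·((N+1)(N+2)/2) · ∫_Q u², and the constant d(N+1)(N+2)/2 is attained by the tensor product of the 1D extremal polynomials. -/

import Mathlib

open MeasureTheory

/-- `∫_Q u²` over the hypercube `Q = [-1,1]^d`. -/
noncomputable def boxInt (d : ℕ) (u : MvPolynomial (Fin d) ℝ) : ℝ :=
  ∫ x in (Set.univ.pi fun _ : Fin d => Set.Icc (-1 : ℝ) 1),
    (MvPolynomial.eval x u) ^ 2

/-- `∫_f u²` over the face `{x_k = s}` of the hypercube `[-1,1]^d`. -/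
noncomputable def faceInt (d : ℕ) (k : Fin d) (s : ℝ)
    (u : MvPolynomial (Fin d) ℝ) : ℝ :=
  ∫ y in (Set.univ.pi fun _ : {i : Fin d // i ≠ k} => Set.Icc (-1 : ℝ) 1),
    (MvPolynomial.eval (fun i => if h : i = k then s else y ⟨i, h⟩) u) ^ 2

/-- `∫_{∂Q} u²`: the sum of the face integrals over the `2d` faces. -/
noncomputable def surfInt (d : ℕ) (u : MvPolynomial (Fin d) ℝ) : ℝ :=
  ∑ k : Fin d, (faceInt d k (-1) u + faceInt d k 1 u)

open Polynomial in
theorem poly_parts (p q : ℝ[X]) (a b : ℝ) :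
    ∫ x in a..b, p.eval x * (derivative q).eval x =
      p.eval b * q.eval b - p.eval a * q.eval a - ∫ x in a..b, (derivative p).eval x * q.eval x :=
  intervalIntegral.integral_mul_deriv_eq_deriv_mul (fun x _ => p.hasDerivAt x)
    (fun x _ => q.hasDerivAt x) ((derivative p).continuous.intervalIntegrable _ _)
    ((derivative q).continuous.intervalIntegrable _ _)

open Polynomial in
theorem poly_orth (w : ℝ[X]) (a b : ℝ) (n : ℕ) (ha : ∀ j < n, (derivative^[j] w).eval a = 0)
    (hb : ∀ j < n, (derivative^[j] w).eval b = 0) (p : ℝ[X]) (hp : derivative^[n] p = 0) :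
    ∫ x in a..b, p.eval x * (derivative^[n] w).eval x = 0 := by
  induction n generalizing p with
  | zero => simp at hp; simp [hp]
  | succ n ih =>
    rw [Function.iterate_succ_apply', poly_parts, ha n (by omega), hb n (by omega),
      ih (fun j hj => ha j (by omega)) (fun j hj => hb j (by omega))]
    · simp
    · rwa [← Function.iterate_succ_apply]

open Polynomial in
noncomputable def legS (n : ℕ) : ℝ[X] := (shiftedLegendre n).map (Int.castRingHom ℝ)

open Polynomial in
theorem legS_orth (n : ℕ) (p : ℝ[X]) (hp : derivative^[n] p = 0) :
    ∫ x in (0:ℝ)..1, p.eval x * (legS n).eval x = 0 := by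
  have h := poly_orth (X ^ n * (1 - X) ^ n) 0 1 n ?_ ?_ p hp
  · have e : derivative^[n] ((X : ℝ[X]) ^ n * (1 - X) ^ n) = C (n.factorial : ℝ) * legS n := by
      have := congrArg (Polynomial.map (Int.castRingHom ℝ)) (factorial_mul_shiftedLegendre_eq n)
      rw [← Polynomial.iterate_derivative_map] at this
      simp at this
      rw [← this, legS]; simp
    rw [e] at h
    simp only [eval_mul, eval_C] at h
    simp_rw [mul_left_comm] at h
    rw [intervalIntegral.integral_const_mul] at h
    rcases mul_eq_zero.1 h with h | h
    · exact absurd h (by positivity)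
    · exact h
  · intro j hj
    have : (X - C (0:ℝ)) ^ n ∣ X ^ n * (1 - X) ^ n := by simp
    have := pow_sub_dvd_iterate_derivative_of_pow_dvd j this
    have := (dvd_pow_self _ (by omega : n - j ≠ 0)).trans this
    exact dvd_iff_isRoot.1 this
  · intro j hj
    have : (X - C (1:ℝ)) ^ n ∣ X ^ n * (1 - X) ^ n := by
      refine Dvd.dvd.mul_left (pow_dvd_pow_of_dvd ⟨-1, by simp⟩ n) _
    have := pow_sub_dvd_iterate_derivative_of_pow_dvd j this
    have := (dvd_pow_self _ (by omega : n - j ≠ 0)).trans this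
    exact dvd_iff_isRoot.1 this

open Polynomial in
/-- Legendre polynomials on `[-1,1]`. -/
noncomputable def legP (n : ℕ) : ℝ[X] := (legS n).comp (C (1/2) - C (1/2) * X)

open Polynomial in
theorem legP_orth (n : ℕ) (p : ℝ[X]) (hp : p.natDegree < n) :
    ∫ x in (-1:ℝ)..1, p.eval x * (legP n).eval x = 0 := by
  have h := legS_orth n (p.comp (1 - C 2 * X)) ?_
  · have := intervalIntegral.integral_comp_sub_mul (a := -1) (b := 1)
      (fun s => (p.comp (1 - C 2 * X)).eval s * (legS n).eval s) (c := 1/2) (by norm_num) (1/2)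
    norm_num at this
    simp only [one_div, eval_comp, eval_sub, eval_one, eval_mul, eval_X, eval_C] at this h ⊢
    rw [h] at this
    rw [← mul_zero (2:ℝ), ← this]
    simp only [legP, eval_comp, eval_sub, eval_mul, eval_X, eval_C]
    norm_num
    ring_nf
  · apply iterate_derivative_eq_zero
    refine lt_of_le_of_lt natDegree_comp_le ?_
    have : (1 - C 2 * X : ℝ[X]).natDegree ≤ 1 := by compute_degree
    nlinarith

open Polynomial in
theorem legP_symm (n : ℕ) : legP n = (-1) ^ n * (legP n).comp (-X) := by
  have := congrArg (Polynomial.map (Int.castRingHom ℝ))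
    (neg_one_pow_mul_shiftedLegendre_comp_one_sub_X_eq n)
  simp [Polynomial.map_comp] at this
  change _ * (legS n).comp _ = legS n at this
  rw [legP]
  nth_rw 1 [← this]
  simp only [mul_comp, pow_comp, comp_assoc, sub_comp, neg_comp, one_comp, X_comp, C_comp]
  congr 2
  have : (1 : ℝ[X]) = C (1/2) + C (1/2) := by rw [← C_add]; norm_num
  rw [this]
  ring

open Polynomial in
theorem legP_one (n : ℕ) : (legP n).eval 1 = 1 := by
  simp [legP, eval_comp]
  rw [← coeff_zero_eq_eval_zero, legS, coeff_map, coeff_shiftedLegendre]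
  simp

open Polynomial in
theorem legP_neg_one (n : ℕ) : (legP n).eval (-1) = (-1) ^ n := by
  rw [legP_symm]
  simp [eval_comp, legP_one]

open Polynomial in
theorem legP_der_one (n : ℕ) : (derivative (legP n)).eval 1 = n * (n + 1) / 2 := by
  rw [legP, derivative_comp]
  simp [eval_comp]
  rw [← coeff_zero_eq_eval_zero, coeff_derivative, legS, coeff_map, coeff_shiftedLegendre]
  simp
  ring

open Polynomial in
theorem legP_der_neg_one (n : ℕ) :
    (derivative (legP n)).eval (-1) = - (-1) ^ n * (n * (n + 1) / 2) := by
  rw [legP_symm]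
  have : ((-1) ^ n : ℝ[X]) = C ((-1) ^ n) := by simp
  rw [this, derivative_C_mul, derivative_comp]
  simp [eval_comp, legP_der_one]

open Polynomial in
theorem legP_der_natDegree (n : ℕ) : (derivative (legP (n + 1))).natDegree ≤ n := by
  refine (natDegree_derivative_le _).trans ?_
  have h1 : (legP (n + 1)).natDegree ≤ (legS (n + 1)).natDegree * 1 := by
    refine natDegree_comp_le.trans (Nat.mul_le_mul_left _ ?_)
    compute_degree
  have h2 : (legS (n + 1)).natDegree ≤ n + 1 := by
    refine natDegree_map_le.trans ?_
    simp
  omega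

open Polynomial in
theorem legP_repr (n : ℕ) (p : ℝ[X]) (hp : p.natDegree ≤ n) :
    ∫ x in (-1:ℝ)..1, p.eval x * (derivative (legP n)).eval x =
      p.eval 1 - (-1) ^ n * p.eval (-1) := by
  rw [poly_parts, legP_one, legP_neg_one]
  rcases Nat.eq_zero_or_pos n with rfl | hn
  · have hp := eq_C_of_natDegree_le_zero hp
    rw [hp]; simp
  · rw [legP_orth n (derivative p)]
    · ring
    · have := natDegree_derivative_le p; omega

open Polynomial in
theorem trace_one_eq (N : ℕ) :
    ∫ x in (-1:ℝ)..1, (derivative (legP (N+1))).eval x * (derivative (legP (N+1))).eval x =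
      (N + 1) * (N + 2) := by
  rw [legP_repr (N+1) _ ((legP_der_natDegree N).trans (by omega)), legP_der_one, legP_der_neg_one]
  rcases neg_one_pow_eq_or ℝ (N+1) with h | h <;> rw [h] <;> push_cast <;> ring

open Polynomial in
theorem trace_one (N : ℕ) (p : ℝ[X]) (hp : p.natDegree ≤ N) :
    p.eval (-1) ^ 2 + p.eval 1 ^ 2 ≤
      (((N : ℝ) + 1) * ((N : ℝ) + 2) / 2) * ∫ x in (-1:ℝ)..1, p.eval x ^ 2 := by
  have h11 := trace_one_eq N
  have hd2 : (derivative (legP N)).natDegree ≤ N := by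
    rcases N with _ | n
    · simp [legP, legS, shiftedLegendre]
    · exact (legP_der_natDegree n).trans (by omega)
  have h22 := legP_repr N _ hd2
  have h12 := legP_repr (N+1) _ (hd2.trans (Nat.le_succ N))
  have h1 := legP_repr (N+1) p (hp.trans (Nat.le_succ N))
  have h2 := legP_repr N p hp
  rw [legP_der_one, legP_der_neg_one] at h22 h12
  set q1 := derivative (legP (N+1))
  set q2 := derivative (legP N)
  set σ : ℝ := (-1) ^ N with hσ
  have hσ2 : σ * σ = 1 := by rcases neg_one_pow_eq_or ℝ N with h | h <;> rw [hσ, h] <;> norm_num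
  rw [pow_succ, ← hσ] at h1 h12
  have h12' : ∫ x in (-1:ℝ)..1, q2.eval x * q1.eval x = 0 := by rw [h12]; linear_combination (-(N:ℝ) * (N+1)/2) * hσ2
  have h22' : ∫ x in (-1:ℝ)..1, q2.eval x * q2.eval x = N * (N+1) := by
    rw [h22]; linear_combination ((N:ℝ) * (N+1)/2) * hσ2
  set A := p.eval 1 - σ * -1 * p.eval (-1) with hA
  set B := p.eval 1 - σ * p.eval (-1) with hB
  have hsum : p.eval (-1) ^ 2 + p.eval 1 ^ 2 = (A^2+B^2)/2 := by
    rw [hA, hB]; linear_combination (- p.eval (-1) ^ 2) * hσ2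
  have key : ∀ a b : ℝ, 0 ≤ (∫ x in (-1:ℝ)..1, p.eval x ^ 2) - 2 * a * A - 2 * b * B
      + a ^ 2 * ((N+1)*(N+2)) + b ^ 2 * (N * (N+1)) := by
    intro a b
    have h0 : 0 ≤ ∫ x in (-1:ℝ)..1, (p.eval x - a * q1.eval x - b * q2.eval x) ^ 2 :=
      intervalIntegral.integral_nonneg (by norm_num) (fun x _ => sq_nonneg _)
    have e : ∀ x, (p.eval x - a * q1.eval x - b * q2.eval x) ^ 2 =
      p.eval x ^ 2 - (2 * a) * (p.eval x * q1.eval x) - (2 * b) * (p.eval x * q2.eval x)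
       + a ^ 2 * (q1.eval x * q1.eval x) + b ^ 2 * (q2.eval x * q2.eval x)
       + (2 * a * b) * (q2.eval x * q1.eval x) := fun x => by ring
    simp_rw [e] at h0
    have hc := fun r : ℝ[X] => r.continuous
    rw [intervalIntegral.integral_add, intervalIntegral.integral_add,
      intervalIntegral.integral_add, intervalIntegral.integral_sub,
      intervalIntegral.integral_sub] at h0
    · simp only [intervalIntegral.integral_const_mul] at h0
      rw [h1, h2, h12', h22', h11] at h0
      linarith
    all_goals apply Continuous.intervalIntegrable; fun_prop
  set I := ∫ x in (-1:ℝ)..1, p.eval x ^ 2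
  have hC : (0:ℝ) < (N+1)*(N+2) := by positivity
  have k := key (A / ((N+1)*(N+2))) (B / ((N+1)*(N+2)))
  have k2 : 0 ≤ I * ((N+1)*(N+2)) - A^2 - B^2 - B^2 * (2 / (N+2)) := by
    have := mul_nonneg hC.le k
    have e : ((N:ℝ)+1)*(N+2) * (I - 2 * (A / ((N+1)*(N+2))) * A - 2 * (B / ((N+1)*(N+2))) * B
      + (A / ((N+1)*(N+2))) ^ 2 * ((N+1)*(N+2)) + (B / ((N+1)*(N+2))) ^ 2 * (N * (N+1))) =
      I * ((N+1)*(N+2)) - A^2 - B^2 - B^2 * (2 / (N+2)) := by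
      field_simp
      ring
    rw [e] at this
    exact this
  have : 0 ≤ B^2 * (2 / ((N:ℝ)+2)) := by positivity
  rw [hsum]
  linarith

/-- insert coordinate -/
def insK {d : ℕ} (k : Fin d) (t : ℝ) (y : {i : Fin d // i ≠ k} → ℝ) : Fin d → ℝ :=
  fun i => if h : i = k then t else y ⟨i, h⟩

theorem insK_cont {d : ℕ} (k : Fin d) :
    Continuous (fun z : ({i : Fin d // i ≠ k} → ℝ) × ℝ => insK k z.2 z.1) := by
  refine continuous_pi fun i => ?_
  unfold insK
  by_cases h : i = k
  · simp only [h, dif_pos]; fun_prop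
  · simp only [h, dif_neg, not_false_eq_true]; fun_prop

theorem box_fubini {d : ℕ} (k : Fin d) (f : (Fin d → ℝ) → ℝ) (hf : Continuous f) :
    ∫ x in (Set.univ.pi fun _ : Fin d => Set.Icc (-1 : ℝ) 1), f x =
    ∫ y in (Set.univ.pi fun _ : {i : Fin d // i ≠ k} => Set.Icc (-1 : ℝ) 1),
      ∫ t in (-1:ℝ)..1, f (insK k t y) := by
  have m1 : MeasurePreserving (MeasurableEquiv.piEquivPiSubtypeProd (fun _ : Fin d => ℝ)
      (fun i => i = k)).symm (volume.prod volume) volume := by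
    convert (volume_preserving_piEquivPiSubtypeProd (fun _ : Fin d => ℝ) (fun i => i = k)).symm
    · rfl
    · rw [Measure.volume_eq_prod]; congr!
  have m2a : @MeasurePreserving _ _ _ _ (MeasurableEquiv.funUnique {i : Fin d // i = k} ℝ).symm volume
      (@volume _ (@MeasureSpace.pi _ (Fintype.subtypeEq k) (fun _ => ℝ) _)) := by
    convert (volume_preserving_funUnique {i : Fin d // i = k} ℝ).symm
  have m2 := m2a.prod
    (MeasurePreserving.id (volume : Measure ({i : Fin d // ¬ i = k} → ℝ)))
  have m3 : MeasurePreserving (Prod.swap : (({i : Fin d // ¬ i = k} → ℝ) × ℝ) → _)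
    (volume.prod volume) (volume.prod volume) := Measure.measurePreserving_swap
  have m := m1.comp (m2.comp m3)
  set e : (({i : Fin d // ¬ i = k} → ℝ) × ℝ) ≃ᵐ (Fin d → ℝ) :=
    (MeasurableEquiv.prodComm.trans ((MeasurableEquiv.funUnique {i : Fin d // i = k} ℝ).symm.prodCongr
      (MeasurableEquiv.refl ({i : Fin d // ¬ i = k} → ℝ)))).trans
      (MeasurableEquiv.piEquivPiSubtypeProd (fun _ : Fin d => ℝ) (fun i => i = k)).symm with he
  have m' : MeasurePreserving e (volume.prod volume) volume := m
  have hap : ∀ z, e z = insK k z.2 z.1 := by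
    intro z
    rfl
  rw [← m'.setIntegral_preimage_emb e.measurableEmbedding]
  have hs : e ⁻¹' (Set.univ.pi fun _ : Fin d => Set.Icc (-1 : ℝ) 1) =
      (Set.univ.pi fun _ : {i : Fin d // ¬ i = k} => Set.Icc (-1 : ℝ) 1) ×ˢ Set.Icc (-1:ℝ) 1 := by
    ext z
    simp only [Set.mem_preimage, Set.mem_univ_pi, Set.mem_prod, hap, insK]
    constructor
    · intro h
      refine ⟨fun i => ?_, ?_⟩
      · have := h i.1
        rwa [dif_neg i.2] at this
      · have := h k
        rwa [dif_pos rfl] at this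
    · rintro ⟨h1, h2⟩ i
      by_cases h : i = k
      · rw [dif_pos h]; exact h2
      · rw [dif_neg h]; exact h1 ⟨i, h⟩
  rw [hs]
  simp_rw [hap]
  rw [setIntegral_prod]
  · simp_rw [intervalIntegral.integral_of_le (by norm_num : (-1:ℝ) ≤ 1), ← integral_Icc_eq_integral_Ioc]
  · refine ContinuousOn.integrableOn_compact ?_ ?_
    · exact (isCompact_univ_pi fun _ => isCompact_Icc).prod isCompact_Icc
    · exact (hf.comp (insK_cont k)).continuousOn

open Polynomial in
/-- restriction to a line -/
noncomputable def lineP {d : ℕ} (k : Fin d) (y : {i : Fin d // i ≠ k} → ℝ)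
    (u : MvPolynomial (Fin d) ℝ) : ℝ[X] :=
  MvPolynomial.aeval (fun i => if h : i = k then (X : ℝ[X]) else C (y ⟨i, h⟩)) u

open Polynomial in
theorem lineP_eval {d : ℕ} (k : Fin d) (y : {i : Fin d // i ≠ k} → ℝ)
    (u : MvPolynomial (Fin d) ℝ) (t : ℝ) :
    (lineP k y u).eval t = MvPolynomial.eval (insK k t y) u := by
  unfold lineP
  rw [← Polynomial.coe_aeval_eq_eval, ← MvPolynomial.coe_aeval_eq_eval]
  change (Polynomial.aeval t) _ = MvPolynomial.aeval _ u
  rw [← AlgHom.comp_apply, MvPolynomial.comp_aeval]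
  congr 2
  funext i
  unfold insK
  split_ifs <;> simp

open Polynomial in
theorem lineP_natDegree {d : ℕ} (k : Fin d) (y : {i : Fin d // i ≠ k} → ℝ)
    (u : MvPolynomial (Fin d) ℝ) : (lineP k y u).natDegree ≤ u.degreeOf k := by
  unfold lineP
  rw [MvPolynomial.aeval_def, MvPolynomial.eval₂_eq']
  refine natDegree_sum_le_of_forall_le _ _ fun m hm => ?_
  refine (natDegree_C_mul_le _ _).trans ?_
  refine (natDegree_prod_le _ _).trans ?_
  rw [Finset.sum_eq_single k]
  · simp only [dif_pos]
    rw [natDegree_X_pow]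
    exact MvPolynomial.monomial_le_degreeOf k hm
  · intro i _ hi
    rw [dif_neg hi, ← C_pow, natDegree_C]
  · simp

theorem face_sum {d : ℕ} (k : Fin d) (u : MvPolynomial (Fin d) ℝ) :
    faceInt d k (-1) u + faceInt d k 1 u =
    ∫ y in (Set.univ.pi fun _ : {i : Fin d // i ≠ k} => Set.Icc (-1 : ℝ) 1),
      ((lineP k y u).eval (-1) ^ 2 + (lineP k y u).eval 1 ^ 2) := by
  have hc : ∀ s : ℝ, IntegrableOn (fun y => (lineP k y u).eval s ^ 2)
      (Set.univ.pi fun _ : {i : Fin d // i ≠ k} => Set.Icc (-1 : ℝ) 1) := by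
    intro s
    simp_rw [lineP_eval]
    refine ContinuousOn.integrableOn_compact (isCompact_univ_pi fun _ => isCompact_Icc) ?_
    have h1 : Continuous fun y : {i : Fin d // i ≠ k} → ℝ => insK k s y :=
      (insK_cont k).comp (f := fun y => (y, s)) (by fun_prop)
    exact (((MvPolynomial.continuous_eval u).comp h1).pow 2).continuousOn
  rw [integral_add (hc _) (hc _)]
  simp_rw [lineP_eval]
  rfl

theorem box_line {d : ℕ} (k : Fin d) (u : MvPolynomial (Fin d) ℝ) :
    boxInt d u =
    ∫ y in (Set.univ.pi fun _ : {i : Fin d // i ≠ k} => Set.Icc (-1 : ℝ) 1),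
      ∫ t in (-1:ℝ)..1, (lineP k y u).eval t ^ 2 := by
  simp_rw [lineP_eval]
  exact box_fubini k (fun x => MvPolynomial.eval x u ^ 2) ((MvPolynomial.continuous_eval u).pow 2)

theorem face_le {d : ℕ} (N : ℕ) (k : Fin d) (u : MvPolynomial (Fin d) ℝ) (hu : u.degreeOf k ≤ N) :
    faceInt d k (-1) u + faceInt d k 1 u ≤ (((N : ℝ) + 1) * ((N : ℝ) + 2) / 2) * boxInt d u := by
  rw [face_sum, box_line k, ← integral_const_mul]
  have hK : IsCompact (Set.univ.pi fun _ : {i : Fin d // i ≠ k} => Set.Icc (-1 : ℝ) 1) :=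
    isCompact_univ_pi fun _ => isCompact_Icc
  have hj : Continuous fun z : ({i : Fin d // i ≠ k} → ℝ) × ℝ => (lineP k z.1 u).eval z.2 := by
    simp_rw [lineP_eval]
    exact (MvPolynomial.continuous_eval u).comp (insK_cont k)
  have hs : ∀ s : ℝ, Continuous fun y : ({i : Fin d // i ≠ k} → ℝ) => (lineP k y u).eval s :=
    fun s => hj.comp (f := fun y => (y, s)) (by fun_prop)
  refine setIntegral_mono ?_ ?_ fun y => trace_one N _ ((lineP_natDegree k y u).trans hu)
  · exact (((hs _).pow 2).add ((hs _).pow 2)).continuousOn.integrableOn_compact hK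
  · refine ContinuousOn.integrableOn_compact hK (Continuous.continuousOn ?_)
    refine continuous_const.mul ?_
    exact intervalIntegral.continuous_parametric_intervalIntegral_of_continuous'
      (f := fun y t => (lineP k y u).eval t ^ 2) (by rw [Function.uncurry_def]; fun_prop) _ _

open Polynomial in
noncomputable def extr (d N : ℕ) : MvPolynomial (Fin d) ℝ :=
  ∏ j : Fin d, Polynomial.aeval (MvPolynomial.X j) (derivative (legP (N+1)))

open Polynomial in
theorem extr_eval (d N : ℕ) (x : Fin d → ℝ) :
    MvPolynomial.eval x (extr d N) = ∏ j, (derivative (legP (N+1))).eval (x j) := by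
  unfold extr
  rw [map_prod]
  refine Finset.prod_congr rfl fun j _ => ?_
  rw [← MvPolynomial.coe_aeval_eq_eval, ← Polynomial.coe_aeval_eq_eval]
  change MvPolynomial.aeval x _ = _
  rw [← Polynomial.aeval_algHom_apply]
  simp

open Polynomial in
theorem extr_deg (d N : ℕ) (k : Fin d) : (extr d N).degreeOf k ≤ N := by
  refine (MvPolynomial.degreeOf_prod_le _ _ _).trans ?_
  have h : ∀ j, (Polynomial.aeval (MvPolynomial.X j : MvPolynomial (Fin d) ℝ)
      (derivative (legP (N+1)))).degreeOf k ≤ if j = k then N else 0 := by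
    intro j
    rw [Polynomial.aeval_eq_sum_range]
    refine (MvPolynomial.degreeOf_sum_le _ _ _).trans (Finset.sup_le fun i hi => ?_)
    rw [MvPolynomial.smul_eq_C_mul]
    refine (MvPolynomial.degreeOf_C_mul_le _ _ _).trans ?_
    refine (MvPolynomial.degreeOf_pow_le _ _ _).trans ?_
    rw [MvPolynomial.degreeOf_X]
    have := legP_der_natDegree N
    rw [Finset.mem_range] at hi
    by_cases hjk : j = k
    · simp [hjk]; omega
    · simp [hjk, Ne.symm hjk]
  refine (Finset.sum_le_sum fun j _ => h j).trans ?_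
  simp

open Polynomial in
theorem extr_face (d N : ℕ) (k : Fin d) :
    faceInt d k (-1) (extr d N) + faceInt d k 1 (extr d N) =
      (((N : ℝ) + 1) * ((N : ℝ) + 2) / 2) * boxInt d (extr d N) := by
  rw [face_sum, box_line k, ← integral_const_mul]
  refine integral_congr_ae (Filter.Eventually.of_forall fun y => ?_)
  have h : ∀ t, (lineP k y (extr d N)).eval t = (derivative (legP (N+1))).eval t *
      ∏ j ∈ Finset.univ.erase k, (derivative (legP (N+1))).eval (insK k 0 y j) := by
    intro t
    rw [lineP_eval, extr_eval, ← Finset.mul_prod_erase _ _ (Finset.mem_univ k)]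
    congr 1
    · simp [insK]
    · refine Finset.prod_congr rfl fun j hj => ?_
      have := Finset.ne_of_mem_erase hj
      simp [insK, this]
  simp only [h, mul_pow, intervalIntegral.integral_mul_const]
  simp only [pow_two ((derivative (legP (N+1))).eval _)]
  rw [trace_one_eq, legP_der_one, legP_der_neg_one]
  rcases neg_one_pow_eq_or ℝ (N+1) with h | h <;> rw [h] <;> push_cast <;> ring

/-- Surface trace inequality on the `d`-dimensional hypercube `[-1,1]^d` for
tensor-product polynomials of degree at most `N` in each variable:
`∫_{∂Q} u² ≤ d (N+1)(N+2)/2 ∫_Q u²`, and the constant is attained. -/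
theorem hypercube_trace_inequality (d N : ℕ) (hd : 0 < d) :
    (∀ u : MvPolynomial (Fin d) ℝ, (∀ k, u.degreeOf k ≤ N) →
      surfInt d u ≤ (d : ℝ) * (((N : ℝ) + 1) * ((N : ℝ) + 2) / 2) * boxInt d u) ∧
    ∃ u : MvPolynomial (Fin d) ℝ, u ≠ 0 ∧ (∀ k, u.degreeOf k ≤ N) ∧
      surfInt d u = (d : ℝ) * (((N : ℝ) + 1) * ((N : ℝ) + 2) / 2) * boxInt d u := by
  refine ⟨fun u hu => ?_, extr d N, ?_, extr_deg d N, ?_⟩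
  · unfold surfInt
    refine (Finset.sum_le_sum fun k _ => face_le N k u (hu k)).trans (le_of_eq ?_)
    simp
    ring
  · intro h0
    have h := extr_eval d N (fun _ => 1)
    rw [h0, map_zero] at h
    simp only [legP_der_one] at h
    have : (0:ℝ) < ∏ _j : Fin d, ((N + 1 : ℕ) : ℝ) * (((N + 1 : ℕ) : ℝ) + 1) / 2 :=
      Finset.prod_pos fun _ _ => by positivity
    linarith
  · unfold surfInt
    rw [Finset.sum_congr rfl fun k _ => extr_face d N k]
    simp
    ring
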